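/- If G is an edge-colored graph on n vertices with n ≥ k ≥ 4 such that m(G) + c(G) ≥ C(n,2) + t_{n,k−2} + 2ℓ for a positive integer ℓ, then G contains at least ℓ rainbow copies of K_k (i.e., at least ℓ distinct k-vertex complete subgraphs each of which is rainbow). -/

import Mathlib

/-- `s` spans a rainbow clique in the edge-colored graph `(G, col)`:
`s` is a clique and distinct edges inside `s` receive distinct colors. -/
def IsRainbowClique {V : Type*} (G : SimpleGraph V) (col : Sym2 V → ℕ)
    (s : Finset V) : Prop :=
  G.IsClique s ∧
    ∀ a ∈ s, ∀ b ∈ s, ∀ c ∈ s, ∀ d ∈ s, a ≠ b → c ≠ d →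
      s(a, b) ≠ s(c, d) → col s(a, b) ≠ col s(c, d)

/-- `t_{n,r}`: the number of edges of the Turán graph `T_{n,r}`. -/
noncomputable def turanEdges (n r : ℕ) : ℕ :=
  (SimpleGraph.turanGraph n r).edgeSet.ncard

/-- The edge set of the copy of the Turán graph `T_{n,r}` on `Fin n` obtained by
relabelling the vertices of `SimpleGraph.turanGraph n r` along the
permutation `σ`. -/
def turanCopyEdges (n r : ℕ) (σ : Fin n ≃ Fin n) : Set (Sym2 (Fin n)) :=
  {e | e.map σ ∈ (SimpleGraph.turanGraph n r).edgeSet}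

section RainbowCliques

open Finset

variable {V : Type*} [DecidableEq V] {G : SimpleGraph V} {col : Sym2 V → ℕ}

/-- The edges of `G` with both ends in `S`. -/
noncomputable def edgesWithin (G : SimpleGraph V) (S : Finset V) : Finset (Sym2 V) :=
  open Classical in S.sym2.filter (· ∈ G.edgeSet)

/-- The number of edges plus the number of colors of the subgraph induced on `S`. -/
noncomputable def edgesAddColors (G : SimpleGraph V) (col : Sym2 V → ℕ)
    (S : Finset V) : ℕ :=
  #(edgesWithin G S) + #((edgesWithin G S).image col)

/-- `N` selects, at each vertex `v` of `S`, neighbors of `v` joined to `v` by edges of distinct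
colors, each of which occurs inside `S` only on edges incident to `v`. -/
structure IsSaturatedChoice (G : SimpleGraph V) (col : Sym2 V → ℕ) (S : Finset V)
    (N : V → Finset V) : Prop where
  subset : ∀ v ∈ S, N v ⊆ S
  adj : ∀ v ∈ S, ∀ u ∈ N v, G.Adj v u
  inj : ∀ v ∈ S, ∀ u ∈ N v, ∀ w ∈ N v, col s(v, u) = col s(v, w) → u = w
  saturated : ∀ v ∈ S, ∀ u ∈ N v, ∀ x ∈ S, ∀ y ∈ S, x ≠ v → y ≠ v → G.Adj x y →
    col s(x, y) ≠ col s(v, u)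

lemma isRainbowClique_pair {x y : V} (h : G.Adj x y) : IsRainbowClique G col {x, y} := by
  constructor
  · intro a ha b hb hab
    simp only [coe_insert, coe_singleton, Set.mem_insert_iff, Set.mem_singleton_iff] at ha hb
    rcases ha with rfl | rfl <;> rcases hb with rfl | rfl
    exacts [absurd rfl hab, h, h.symm, absurd rfl hab]
  · intro a ha b hb c hc d hd hab hcd hne
    simp only [mem_insert, mem_singleton] at ha hb hc hd
    exfalso
    apply hne
    rw [Sym2.eq_iff]
    grind

namespace IsSaturatedChoice

variable {S : Finset V} {N : V → Finset V} (hN : IsSaturatedChoice G col S N)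
include hN

omit [DecidableEq V] in
lemma notMem_self {v : V} (hv : v ∈ S) : v ∉ N v := fun h => (hN.adj v hv v h).ne rfl

lemma insert_isRainbowClique {v : V} (hv : v ∈ S) {T : Finset V} (hT : T ⊆ N v)
    (hR : IsRainbowClique G col T) : IsRainbowClique G col (insert v T) := by
  have hTS : ∀ x ∈ T, x ∈ S := fun x hx => hN.subset v hv (hT hx)
  have hvT : ∀ x ∈ T, x ≠ v := fun x hx h => hN.notMem_self hv (hT (h ▸ hx))
  have hsat : ∀ u ∈ T, ∀ x ∈ T, ∀ y ∈ T, x ≠ y → col s(x, y) ≠ col s(v, u) :=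
    fun u hu x hx y hy hxy => hN.saturated v hv u (hT hu) x (hTS x hx) y (hTS y hy)
      (hvT x hx) (hvT y hy) (hR.1 hx hy hxy)
  have hinj : ∀ u ∈ T, ∀ w ∈ T, u ≠ w → col s(v, u) ≠ col s(v, w) :=
    fun u hu w hw huw h => huw (hN.inj v hv u (hT hu) w (hT hw) h)
  constructor
  · rw [coe_insert]
    exact hR.1.insert fun b hb _ => hN.adj v hv b (hT hb)
  · have h2 := hR.2
    intro a ha b hb c hc d hd hab hcd hne
    rw [mem_insert] at ha hb hc hd
    rcases ha with rfl | ha <;> rcases hb with rfl | hb <;> rcases hc with rfl | hc <;>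
      rcases hd with rfl | hd <;> first
      | exact absurd rfl hab
      | exact absurd rfl hcd
      | exact h2 a ha b hb c hc d hd hab hcd hne
      | skip
    all_goals grind [Sym2.eq_swap]

lemma exists_isRainbowClique_insert {v : V} {X Y : Finset V} (hX : X ⊆ S) (hv : v ∈ X)
    (hYX : Y ⊆ X) (hYN : Y ⊆ N v) {m : ℕ}
    (h : ∃ T ⊆ Y, #T = m ∧ IsRainbowClique G col T) :
    ∃ T ⊆ X, #T = m + 1 ∧ IsRainbowClique G col T := by
  obtain ⟨T, hTY, hT, hR⟩ := h
  refine ⟨insert v T, insert_subset hv (hTY.trans hYX), ?_,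
    hN.insert_isRainbowClique (hX hv) (hTY.trans hYN) hR⟩
  rw [card_insert_of_notMem fun h => hN.notMem_self (hX hv) (hYN (hTY h)), hT]

end IsSaturatedChoice

section CliqueExtension

variable {S : Finset V} {N : V → Finset V} (hN : IsSaturatedChoice G col S N) {q : ℕ}
  (hq : ∀ v ∈ S, #(S \ N v) ≤ q)
include hq

lemma card_le_card_inter_add {X : Finset V} (hX : X ⊆ S) {v : V} (hv : v ∈ S) :
    #X ≤ #(X ∩ N v) + q := by
  have h1 := card_inter_add_card_sdiff X (N v)
  have h2 := card_le_card (sdiff_subset_sdiff hX (Subset.refl (N v)))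
  have h3 := hq v hv
  omega

include hN

lemma exists_isRainbowClique_of_card_le [DecidableRel G.Adj] (b : ℕ) (j : ℕ) {X : Finset V} (hX : X ⊆ S)
    (hb : ∀ x ∈ X, #{u ∈ S | ¬G.Adj x u} ≤ b) (hcard : j * q + b + 1 ≤ #X) :
    ∃ T ⊆ X, #T = j + 2 ∧ IsRainbowClique G col T := by
  induction j generalizing X with
  | zero =>
    obtain ⟨x, hx⟩ : X.Nonempty := card_pos.1 (by omega)
    obtain ⟨y, hy, hxy⟩ : ∃ y ∈ X, G.Adj x y := by
      by_contra! h
      have h1 : X ⊆ {u ∈ S | ¬G.Adj x u} := fun y hy => mem_filter.2 ⟨hX hy, h y hy⟩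
      have := card_le_card h1
      have := hb x hx
      omega
    exact ⟨{x, y}, by grind, card_pair hxy.ne, isRainbowClique_pair hxy⟩
  | succ j ih =>
    obtain ⟨v, hv⟩ : X.Nonempty := card_pos.1 (by omega)
    have h1 := card_le_card_inter_add hq hX (hX hv)
    exact hN.exists_isRainbowClique_insert hX hv inter_subset_left inter_subset_right
      (ih (inter_subset_left.trans hX) (fun x hx => hb x (mem_inter.1 hx).1)
        (by rw [Nat.succ_mul] at hcard; omega))

lemma exists_isRainbowClique_four (hq2 : 2 ≤ q)
    (hadj : ∀ x ∈ S, ∀ y ∈ S, x ≠ y → G.Adj x y) {X : Finset V} (hX : X ⊆ S)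
    (hcard : 2 * q + 1 ≤ #X) :
    ∃ T ⊆ X, #T = 4 ∧ IsRainbowClique G col T := by
  by_contra! hno
  have hsmall : ∀ v ∈ X, ∀ w ∈ X ∩ N v, #(X ∩ N v ∩ N w) ≤ 1 := by
    intro v hv w hw
    by_contra! h
    obtain ⟨x, hx, y, hy, hxy⟩ := one_lt_card.1 h
    have hsub : X ∩ N v ∩ N w ⊆ X := inter_subset_left.trans inter_subset_left
    have hpair : ∃ T ⊆ X ∩ N v ∩ N w, #T = 2 ∧ IsRainbowClique G col T :=
      ⟨{x, y}, insert_subset hx (singleton_subset_iff.2 hy), card_pair hxy,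
        isRainbowClique_pair (hadj x (hX (hsub hx)) y (hX (hsub hy)) hxy)⟩
    obtain ⟨T, hTX, hT, hR⟩ := hN.exists_isRainbowClique_insert hX hv inter_subset_left
      inter_subset_right (hN.exists_isRainbowClique_insert (inter_subset_left.trans hX) hw
        inter_subset_left inter_subset_right hpair)
    exact hno T hTX hT hR
  have hle : ∀ v ∈ X, #(X \ N v) ≤ q := fun v hv =>
    (card_le_card (sdiff_subset_sdiff hX (Subset.refl _))).trans (hq v (hX hv))
  have hnonempty : ∀ v ∈ X, ∀ w ∈ X ∩ N v, (X ∩ N v ∩ N w).Nonempty := by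
    intro v hv w hw
    have h1 := card_le_card_inter_add hq hX (hX hv)
    have h2 := card_le_card_inter_add hq (inter_subset_left.trans hX : X ∩ N v ⊆ S)
      (hX (mem_inter.1 hw).1)
    exact card_pos.1 (by omega)
  have hdisj : ∀ v ∈ X, ∀ w ∈ X ∩ N v, ∀ y ∈ X, y ∉ N v → y ∈ N w := by
    intro v hv w hw y hy hyv
    by_contra hyw
    have hwX := (mem_inter.1 hw).1
    have h1 := card_inter_add_card_sdiff X (N v)
    have h2 := card_inter_add_card_sdiff (X ∩ N v) (N w)
    have h3 : #((X ∩ N v) \ N w) < #(X \ N w) :=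
      card_lt_card ((ssubset_iff_of_subset (sdiff_subset_sdiff inter_subset_left
        (Subset.refl _))).2 ⟨y, mem_sdiff.2 ⟨hy, hyw⟩, by simp [hyv]⟩)
    have h4 := hle v hv
    have h5 := hle w hwX
    have h6 := hsmall v hv w hw
    omega
  obtain ⟨v, hv⟩ : X.Nonempty := card_pos.1 (by omega)
  obtain ⟨w, hw⟩ : (X ∩ N v).Nonempty :=
    card_pos.1 (by have := card_le_card_inter_add hq hX (hX hv); omega)
  obtain ⟨x, hx⟩ := hnonempty v hv w hw
  have hwX := (mem_inter.1 hw).1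
  have hvv := hN.notMem_self (hX hv)
  obtain ⟨y, hy, hyv⟩ : ∃ y ∈ X \ N v, y ≠ v := by
    have h1 := card_inter_add_card_sdiff X (N v)
    have h2 := card_inter_add_card_sdiff (X ∩ N v) (N w)
    have h4 := card_le_card (sdiff_subset_sdiff (inter_subset_left : X ∩ N v ⊆ X)
      (Subset.refl (N w)))
    have h5 := hle w hwX
    have h6 := hsmall v hv w hw
    exact exists_mem_ne (by omega) v
  simp only [mem_inter, mem_sdiff] at hx hy
  have hxv : x ∈ X ∩ N v := mem_inter.2 hx.1
  have hxX := hx.1.1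
  have hw_y := hdisj v hv w hw y hy.1 hy.2
  have hx_y := hdisj v hv x hxv y hy.1 hy.2
  have hw_v := hdisj v hv w hw v hv hvv
  have hx_v := hdisj v hv x hxv v hv hvv
  have := hsmall w hwX x (mem_inter.2 ⟨hxX, hx.2⟩)
  have hlt : 1 < #(X ∩ N w ∩ N x) :=
    one_lt_card.2 ⟨y, by simp [hy.1, hw_y, hx_y], v, by simp [hv, hw_v, hx_v], hyv⟩
  omega

lemma exists_isRainbowClique_of_complete (hq2 : 2 ≤ q)
    (hadj : ∀ x ∈ S, ∀ y ∈ S, x ≠ y → G.Adj x y) (j : ℕ) {X : Finset V} (hX : X ⊆ S)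
    (hcard : j * q + 2 * q + 1 ≤ #X) :
    ∃ T ⊆ X, #T = j + 4 ∧ IsRainbowClique G col T := by
  induction j generalizing X with
  | zero => simpa using exists_isRainbowClique_four hN hq hq2 hadj hX (by omega)
  | succ j ih =>
    obtain ⟨v, hv⟩ : X.Nonempty := card_pos.1 (by omega)
    have h1 := card_le_card_inter_add hq hX (hX hv)
    exact hN.exists_isRainbowClique_insert hX hv inter_subset_left inter_subset_right
      (ih (inter_subset_left.trans hX) (by rw [Nat.succ_mul] at hcard; omega))

omit hq in
lemma exists_isRainbowClique_of_add_le [DecidableRel G.Adj] {r : ℕ} (hr : 2 ≤ r)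
    (hcard : r * q + 1 ≤ #S) (hcard' : r + 2 ≤ #S)
    (hM : ∀ v ∈ S, #(S \ N v) + #{u ∈ S | ¬G.Adj v u} ≤ q + 1) :
    ∃ T ⊆ S, #T = r + 2 ∧ IsRainbowClique G col T := by
  obtain ⟨r, rfl⟩ := Nat.exists_eq_add_of_le' hr
  have hb : ∀ v ∈ S, 1 ≤ #{u ∈ S | ¬G.Adj v u} := fun v hv =>
    card_pos.2 ⟨v, mem_filter.2 ⟨hv, G.irrefl⟩⟩
  have hq : ∀ v ∈ S, #(S \ N v) ≤ q := fun v hv => by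
    have := hM v hv
    have := hb v hv
    omega
  have hNcard : ∀ v ∈ S, #S + #{u ∈ S | ¬G.Adj v u} ≤ #(N v) + q + 1 := fun v hv => by
    have h1 := card_sdiff_add_card_eq_card (hN.subset v hv)
    have h2 := hM v hv
    omega
  have hmul : (r + 2) * q = r * q + q + q := by ring
  have hmul' : (r + 1) * q = r * q + q := by ring
  obtain ⟨v, hv, hmax⟩ := exists_max_image S (fun v => #{u ∈ S | ¬G.Adj v u})
    (card_pos.1 (by omega))
  have hv1 := hb v hv
  have hv2 := hNcard v hv
  have hNS := hN.subset v hv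
  have hinsert : (∃ T ⊆ N v, #T = r + 1 + 2 ∧ IsRainbowClique G col T) →
      ∃ T ⊆ S, #T = r + 2 + 2 ∧ IsRainbowClique G col T :=
    hN.exists_isRainbowClique_insert (Subset.refl S) hv hNS (Subset.refl _)
  rcases Nat.lt_or_ge ((r + 2) * q + 1) #S with hlt | hge
  · exact hinsert (exists_isRainbowClique_of_card_le hN hq #{u ∈ S | ¬G.Adj v u} (r + 1) hNS
      (fun x hx => hmax x (hNS hx)) (by omega))
  rcases Nat.lt_or_ge 1 #{u ∈ S | ¬G.Adj v u} with hα | hα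
  · by_cases hall : ∀ u ∈ N v, #{w ∈ S | ¬G.Adj u w} ≤ 1
    · exact hinsert (exists_isRainbowClique_of_card_le hN hq 1 (r + 1) hNS hall (by omega))
    push Not at hall
    obtain ⟨u, hu, hu1⟩ := hall
    have h1 := hM u (hNS hu)
    have h2 := card_inter_add_card_sdiff (N v) (N u)
    have h3 := card_le_card (sdiff_subset_sdiff hNS (Subset.refl (N u)))
    exact hinsert (hN.exists_isRainbowClique_insert hNS hu inter_subset_left inter_subset_right
      (exists_isRainbowClique_of_card_le hN hq #{u ∈ S | ¬G.Adj v u} r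
        (inter_subset_left.trans hNS) (fun x hx => hmax x (hNS (mem_inter.1 hx).1)) (by omega)))
  · have hq2 : 2 ≤ q := by
      by_contra! h
      have := Nat.mul_le_mul_left r (Nat.le_of_lt_succ h)
      omega
    refine exists_isRainbowClique_of_complete hN hq hq2 (fun x hx y hy hxy => ?_) r
      (Subset.refl S) (by omega)
    by_contra hnadj
    have hlt : 1 < #{u ∈ S | ¬G.Adj x u} :=
      one_lt_card.2 ⟨x, mem_filter.2 ⟨hx, G.irrefl⟩, y, mem_filter.2 ⟨hy, hnadj⟩, hxy⟩
    have := hmax x hx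
    omega

end CliqueExtension

section VertexDeletion

omit [DecidableEq V] in
lemma mk_mem_edgesWithin {S : Finset V} {x y : V} :
    s(x, y) ∈ edgesWithin G S ↔ x ∈ S ∧ y ∈ S ∧ G.Adj x y := by
  simp [edgesWithin, and_assoc]

lemma card_edgesWithin_le (S : Finset V) : #(edgesWithin G S) ≤ (#S).choose 2 := by
  rw [← Sym2.card_image_offDiag]
  refine card_le_card fun e => ?_
  induction e with | _ x y
  rw [mk_mem_edgesWithin]
  rintro ⟨hx, hy, h⟩
  exact mem_image.2 ⟨(x, y), mem_offDiag.2 ⟨hx, hy, h.ne⟩, rfl⟩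

lemma edgesAddColors_le (S : Finset V) : edgesAddColors G col S ≤ 2 * (#S).choose 2 := by
  have h1 := card_edgesWithin_le (G := G) S
  have h2 : #((edgesWithin G S).image col) ≤ #(edgesWithin G S) := card_image_le
  unfold edgesAddColors
  omega

lemma edgesWithin_eq_union [DecidableRel G.Adj] {S : Finset V} {v : V} (hv : v ∈ S) :
    edgesWithin G S =
      edgesWithin G (S.erase v) ∪ ({u ∈ S | G.Adj v u} : Finset V).image (s(v, ·)) := by
  ext e
  induction e with | _ x y
  simp only [mem_union, mk_mem_edgesWithin, mem_erase, mem_image, mem_filter]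
  constructor
  · rintro ⟨hx, hy, h⟩
    rcases eq_or_ne x v with rfl | hxv
    · exact Or.inr ⟨y, ⟨hy, h⟩, rfl⟩
    rcases eq_or_ne y v with rfl | hyv
    · exact Or.inr ⟨x, ⟨hx, h.symm⟩, Sym2.eq_swap⟩
    exact Or.inl ⟨⟨hxv, hx⟩, ⟨hyv, hy⟩, h⟩
  · rintro (⟨⟨-, hx⟩, ⟨-, hy⟩, h⟩ | ⟨u, ⟨hu, h⟩, he⟩)
    · exact ⟨hx, hy, h⟩
    · rcases Sym2.eq_iff.1 he with ⟨rfl, rfl⟩ | ⟨rfl, rfl⟩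
      exacts [⟨hv, hu, h⟩, ⟨hu, hv, h.symm⟩]

lemma exists_saturated_neighbors [DecidableRel G.Adj] {S : Finset V} {v : V} (hv : v ∈ S) :
    ∃ M ⊆ ({u ∈ S | G.Adj v u} : Finset V),
      (∀ u ∈ M, ∀ w ∈ M, col s(v, u) = col s(v, w) → u = w) ∧
      (∀ u ∈ M, col s(v, u) ∉ (edgesWithin G (S.erase v)).image col) ∧
      edgesAddColors G col S ≤
        edgesAddColors G col (S.erase v) + #{u ∈ S | G.Adj v u} + #M := by
  set A := edgesWithin G (S.erase v) with hA
  set B : Finset V := {u ∈ S | G.Adj v u} with hB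
  have hunion : edgesWithin G S = A ∪ B.image (s(v, ·)) := edgesWithin_eq_union hv
  set C := (edgesWithin G S).image col \ A.image col with hC
  have hsurj : Set.SurjOn (fun u => col s(v, u)) (B : Set V) (C : Set ℕ) := by
    intro c hc
    simp only [hC, hunion, coe_sdiff, Set.mem_sdiff, mem_coe, image_union, mem_union,
      image_image] at hc
    obtain ⟨u, hu, rfl⟩ := mem_image.1 (hc.1.resolve_left hc.2)
    exact ⟨u, hu, rfl⟩
  obtain ⟨M, hMB, hinj, himage⟩ := exists_subset_injOn_image_eq_of_surjOn _ _ hsurj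
  refine ⟨M, by exact_mod_cast hMB, fun u hu w hw h => hinj hu hw h, fun u hu => ?_, ?_⟩
  · have : col s(v, u) ∈ C := by
      rw [← himage]
      exact mem_image_of_mem _ hu
    exact (mem_sdiff.1 this).2
  · have h1 : #(edgesWithin G S) ≤ #A + #B := by
      rw [hunion]
      exact (card_union_le _ _).trans (Nat.add_le_add_left card_image_le _)
    have h2 : #((edgesWithin G S).image col) ≤ #C + #(A.image col) := by
      rw [add_comm]
      exact card_le_card_sdiff_add_card.trans_eq (add_comm _ _)
    have h3 : #M = #C := by rw [← himage, card_image_of_injOn hinj]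
    rw [edgesAddColors, edgesAddColors, ← hA]
    omega

end VertexDeletion

section Turan

lemma turanEdges_eq_card (n r : ℕ) :
    turanEdges n r = #(SimpleGraph.turanGraph n r).edgeFinset := by
  rw [turanEdges, Set.ncard_eq_toFinset_card']
  rfl

lemma turanEdges_of_le {n r : ℕ} (h : n ≤ r) : turanEdges n r = n.choose 2 := by
  rw [turanEdges, SimpleGraph.turanGraph_eq_top.2 (Or.inr h), Set.ncard_eq_toFinset_card']
  have := SimpleGraph.card_edgeFinset_top_eq_card_choose_two (V := Fin n)
  rw [Fintype.card_fin] at this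
  exact this

lemma turanEdges_succ {r : ℕ} (hr : 0 < r) (n : ℕ) :
    turanEdges (n + 1) r = turanEdges n r + (n - n / r) := by
  induction n using Nat.strong_induction_on with
  | _ n ih =>
    rcases Nat.lt_or_ge n r with h | h
    · rw [turanEdges_of_le h, turanEdges_of_le h.le, Nat.div_eq_of_lt h, Nat.choose_succ_succ' n 1,
        Nat.choose_one_right, Nat.sub_zero, add_comm]
    · obtain ⟨m, rfl⟩ := Nat.exists_eq_add_of_le' h
      have h1 := ih m (by omega)
      have h2 := SimpleGraph.card_edgeFinset_turanGraph_add (n := m) (r := r)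
      have h3 := SimpleGraph.card_edgeFinset_turanGraph_add (n := m + 1) (r := r)
      simp only [← turanEdges_eq_card] at h2 h3
      have h4 := Nat.div_le_self m r
      rw [show m + r + 1 = m + 1 + r by omega, h3, h2, h1, Nat.add_div_right m hr, Nat.succ_mul]
      omega

end Turan

/-- The existence of a rainbow clique on `r + 2` vertices, by deleting vertices until every vertex
has many neighbors along colors saturated at it. -/
theorem exists_isRainbowClique_of_le_edgesAddColors {r : ℕ} (hr : 2 ≤ r) (S : Finset V)
    (h : (#S).choose 2 + turanEdges #S r + 2 ≤ edgesAddColors G col S) :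
    ∃ T ⊆ S, #T = r + 2 ∧ IsRainbowClique G col T := by
  classical
  induction hn : #S generalizing S with
  | zero =>
    have := edgesAddColors_le (G := G) (col := col) S
    simp only [hn, Nat.choose_zero_succ] at this h
    omega
  | succ n ih =>
    have hle := edgesAddColors_le (G := G) (col := col) S
    rw [hn] at h hle
    have hchoose : (n + 1).choose 2 = n + n.choose 2 := by
      rw [Nat.choose_succ_succ' n 1, Nat.choose_one_right]
    have hsucc := turanEdges_succ (r := r) (by omega) n
    have hdiv := Nat.div_le_self n r
    have hnr : r + 1 ≤ n := by
      by_contra! hnr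
      have h1 := turanEdges_of_le (Nat.le_of_lt_succ hnr)
      have h2 := Nat.div_le_div_right (c := r) (Nat.le_of_lt_succ hnr)
      rw [Nat.div_self (by omega)] at h2
      omega
    by_contra hno
    choose! N hNsub hNinj hNsat hNcard using
      fun v (hv : v ∈ S) => exists_saturated_neighbors (G := G) (col := col) hv
    have hN : IsSaturatedChoice G col S N :=
      { subset := fun v hv => (hNsub v hv).trans (filter_subset _ _)
        adj := fun v hv u hu => (mem_filter.1 (hNsub v hv hu)).2
        inj := hNinj
        saturated := fun v hv u hu x hx y hy hxv hyv hxy heq => hNsat v hv u hu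
          (mem_image.2 ⟨s(x, y), mk_mem_edgesWithin.2
            ⟨mem_erase.2 ⟨hxv, hx⟩, mem_erase.2 ⟨hyv, hy⟩, hxy⟩, heq⟩) }
    refine hno (exists_isRainbowClique_of_add_le (q := n / r) hN hr ?_ (by omega)
      fun v hv => ?_)
    · have := Nat.mul_div_le n r
      omega
    · have herase : #(S.erase v) = n := by rw [card_erase_of_mem hv, hn, Nat.add_sub_cancel]
      have h1 : ¬ n.choose 2 + turanEdges n r + 2 ≤ edgesAddColors G col (S.erase v) := by
        intro h'
        obtain ⟨T, hTS, hT⟩ := ih (S.erase v) (by rwa [herase]) herase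
        exact hno ⟨T, hTS.trans (erase_subset _ _), hT⟩
      have h2 := hNcard v hv
      have h3 := card_sdiff_add_card_eq_card (hN.subset v hv)
      have h4 := card_filter_add_card_filter_not (s := S) (G.Adj v ·)
      omega

omit [DecidableEq V] in
lemma edgesAddColors_univ [Fintype V] :
    edgesAddColors G col univ = G.edgeSet.ncard + (col '' G.edgeSet).ncard := by
  have h : (edgesWithin G univ : Set (Sym2 V)) = G.edgeSet := by
    ext e
    induction e with | _ x y
    rw [mem_coe, mk_mem_edgesWithin]
    simp
  rw [← h, Set.ncard_coe_finset, ← coe_image, Set.ncard_coe_finset, edgesAddColors]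

lemma ncard_add_ncard_image_le_deleteEdges [Finite V] (e : Sym2 V) :
    G.edgeSet.ncard + (col '' G.edgeSet).ncard ≤
      (G.deleteEdges {e}).edgeSet.ncard + (col '' (G.deleteEdges {e}).edgeSet).ncard + 2 := by
  have h : G.edgeSet ⊆ insert e (G.deleteEdges {e}).edgeSet := by
    intro x hx
    rw [SimpleGraph.edgeSet_deleteEdges]
    by_cases hxe : x = e
    exacts [Or.inl hxe, Or.inr ⟨hx, hxe⟩]
  have h1 := (Set.ncard_le_ncard h (Set.toFinite _)).trans (Set.ncard_insert_le _ _)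
  have h2 := Set.ncard_le_ncard (Set.image_mono (f := col) h) (Set.toFinite _)
  rw [Set.image_insert_eq] at h2
  have h3 := h2.trans (Set.ncard_insert_le _ _)
  omega

/-- Deleting an edge of a rainbow clique lowers the number of edges plus colors by at most two and
the number of rainbow cliques by at least one. -/
theorem le_ncard_isRainbowClique [Fintype V] {r : ℕ} (hr : 2 ≤ r) (l : ℕ)
    (h : (Fintype.card V).choose 2 + turanEdges (Fintype.card V) r + 2 * l ≤
      G.edgeSet.ncard + (col '' G.edgeSet).ncard) :
    l ≤ {s : Finset V | #s = r + 2 ∧ IsRainbowClique G col s}.ncard := by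
  induction l generalizing G with
  | zero => exact Nat.zero_le _
  | succ l ih =>
    obtain ⟨T, -, hT, hR⟩ := exists_isRainbowClique_of_le_edgesAddColors (G := G) (col := col)
      hr univ (by rw [edgesAddColors_univ, card_univ]; omega)
    obtain ⟨x, hx, y, hy, hxy⟩ := one_lt_card.1 (by omega : 1 < #T)
    have h1 := ncard_add_ncard_image_le_deleteEdges (G := G) (col := col) s(x, y)
    refine (Nat.succ_le_succ (ih (G := G.deleteEdges {s(x, y)}) (by omega))).trans
      (Set.ncard_lt_ncard ?_ (Set.toFinite _))
    refine (Set.ssubset_iff_of_subset ?_).2 ⟨T, ⟨hT, hR⟩, fun h' => ?_⟩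
    · rintro s ⟨hs, hclique, hcol⟩
      exact ⟨hs, hclique.mono (SimpleGraph.deleteEdges_le _), hcol⟩
    · simpa using h'.2.1 hx hy hxy

end RainbowCliques

/-- If `G` is an edge-colored graph on `n ≥ k ≥ 4` vertices with
`m(G) + c(G) ≥ (n choose 2) + t_{n,k-2} + 2ℓ` for a positive integer `ℓ`, then
`G` contains at least `ℓ` rainbow copies of `K_k`. -/
theorem stmt_13 (n k l : ℕ) (hk : 4 ≤ k) (hkn : k ≤ n) (hl : 1 ≤ l)
    (G : SimpleGraph (Fin n)) (col : Sym2 (Fin n) → ℕ)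
    (h : n.choose 2 + turanEdges n (k - 2) + 2 * l ≤
      G.edgeSet.ncard + (col '' G.edgeSet).ncard) :
    l ≤ {s : Finset (Fin n) | s.card = k ∧ IsRainbowClique G col s}.ncard := by
  obtain ⟨r, rfl⟩ := Nat.exists_eq_add_of_le' (show 2 ≤ k by omega)
  simpa using le_ncard_isRainbowClique (G := G) (col := col) (r := r) (by omega) l (by simpa using h)
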